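/- Let z_1, …, z_d be an orthonormal basis of R^d and let v_1, …, v_d be unit vectors such that v_i ∈ span{z_1, …, z_i} and ⟨v_i, z_i⟩ ≥ √((d−i+1)/d) for all i = 1, …, d. Then the simplex S = conv{0, v_1, …, v_d} satisfies vol(S) ≥ 1 / ( √(d!) · d^{d/2} ). -/

import Mathlib

open MeasureTheory
open scoped RealInnerProductSpace

/-- The monotone tuples in the unit cube. -/
def orderedSimplex (d : ℕ) : Set (Fin d → ℝ) :=
  {x | Monotone x ∧ ∀ i, x i ∈ Set.Icc (0 : ℝ) 1}

/-- The corner simplex spanned by the origin and the standard basis vectors. -/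
def cornerSimplex (d : ℕ) : Set (Fin d → ℝ) :=
  {x | (∀ i, 0 ≤ x i) ∧ ∑ i, x i ≤ 1}

lemma measurableSet_orderedSimplex (d : ℕ) : MeasurableSet (orderedSimplex d) := by
  have h : orderedSimplex d =
      {x | Monotone x} ∩ Set.univ.pi fun _ => Set.Icc (0 : ℝ) 1 := by
    ext x; simp only [orderedSimplex, Set.mem_ofPred_eq, Set.mem_inter_iff, Set.mem_univ_pi]
  rw [h]
  refine MeasurableSet.inter ?_ (MeasurableSet.univ_pi fun _ => measurableSet_Icc)
  have h' : {x : Fin d → ℝ | Monotone x} = ⋂ i, ⋂ j, ⋂ _ : i ≤ j, {x | x i ≤ x j} := by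
    ext x; simp [Monotone]
  rw [h']
  exact MeasurableSet.iInter fun i => MeasurableSet.iInter fun j => MeasurableSet.iInter fun _ =>
    measurableSet_le (measurable_pi_apply i) (measurable_pi_apply j)

lemma one_le_factorial_mul_volume_orderedSimplex (d : ℕ) :
    1 ≤ (d.factorial : ENNReal) * volume (orderedSimplex d) := by
  have hcover : (Set.univ.pi fun _ : Fin d => Set.Icc (0 : ℝ) 1) ⊆
      ⋃ σ : Equiv.Perm (Fin d), (fun x : Fin d → ℝ => x ∘ σ) ⁻¹' orderedSimplex d := by
    intro x hx
    refine Set.mem_iUnion.2 ⟨Tuple.sort x, Tuple.monotone_sort x, fun i => ?_⟩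
    exact hx _ (Set.mem_univ _)
  have hperm (σ : Equiv.Perm (Fin d)) :
      volume ((fun x : Fin d → ℝ => x ∘ σ) ⁻¹' orderedSimplex d) = volume (orderedSimplex d) := by
    have h := volume_measurePreserving_piCongrLeft (fun _ : Fin d => ℝ) σ.symm
    have he : ⇑(MeasurableEquiv.piCongrLeft (fun _ : Fin d => ℝ) σ.symm) =
        fun x : Fin d → ℝ => x ∘ σ := by
      ext x i
      simp [MeasurableEquiv.coe_piCongrLeft, Equiv.piCongrLeft_apply]
    rw [he] at h
    exact h.measure_preimage (measurableSet_orderedSimplex d).nullMeasurableSet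
  calc (1 : ENNReal) = volume (Set.univ.pi fun _ : Fin d => Set.Icc (0 : ℝ) 1) := by
        rw [volume_pi_pi]
        simp
    _ ≤ ∑ σ : Equiv.Perm (Fin d), volume
          ((fun x : Fin d → ℝ => x ∘ σ) ⁻¹' orderedSimplex d) :=
        (measure_mono hcover).trans (measure_iUnion_fintype_le _ _)
    _ = _ := by simp [hperm, Fintype.card_perm]

/-- The partial-sum matrix. -/
def partialSumMatrix (d : ℕ) : Matrix (Fin d) (Fin d) ℝ :=
  Matrix.of fun i j => if j ≤ i then 1 else 0

lemma det_partialSumMatrix (d : ℕ) : (partialSumMatrix d).det = 1 := by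
  rw [Matrix.det_of_isLowerTriangular]
  · simp [partialSumMatrix]
  · intro i j hij
    have : i < j := hij
    simp [partialSumMatrix, this]

lemma partialSumMatrix_mulVec {d : ℕ} (x : Fin d → ℝ) (i : Fin d) :
    (partialSumMatrix d).mulVec x i = ∑ j ∈ Finset.Iic i, x j := by
  simp only [partialSumMatrix, Matrix.mulVec, dotProduct, Matrix.of_apply, ite_mul, one_mul,
    zero_mul, ← Finset.sum_filter]
  congr 1
  ext j; simp

lemma orderedSimplex_subset_image_cornerSimplex (d : ℕ) :
    orderedSimplex d ⊆ Matrix.toLin' (partialSumMatrix d) '' cornerSimplex d := by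
  rintro x ⟨hmono, hx⟩
  have hdet : IsUnit (partialSumMatrix d).det := by simp [det_partialSumMatrix]
  obtain ⟨y, rfl⟩ : ∃ y, (partialSumMatrix d).mulVec y = x :=
    ⟨(partialSumMatrix d)⁻¹.mulVec x, by simp [Matrix.mulVec_mulVec, Matrix.mul_nonsing_inv _ hdet]⟩
  refine ⟨y, ⟨fun i => ?_, ?_⟩, by simp⟩
  · cases d with
    | zero => exact i.elim0
    | succ n =>
      induction i using Fin.cases with
      | zero =>
        have h := (hx 0).1
        rw [partialSumMatrix_mulVec] at h
        have : (Finset.Iic (0 : Fin (n + 1))) = {0} := by ext j; simp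
        simpa [this] using h
      | succ i =>
        have h := hmono i.castSucc_lt_succ.le
        rw [partialSumMatrix_mulVec, partialSumMatrix_mulVec] at h
        have hI : Finset.Iic i.succ = insert i.succ (Finset.Iic i.castSucc) := by
          ext j; simp only [Finset.mem_Iic, Finset.mem_insert, Fin.le_def, Fin.ext_iff]
          simp only [Fin.val_succ, Fin.val_castSucc]
          omega
        rw [hI, Finset.sum_insert (by simp [Fin.le_def])] at h
        linarith
  · cases d with
    | zero => simp
    | succ n =>
      have h := (hx (Fin.last n)).2
      rw [partialSumMatrix_mulVec] at h
      have hI : Finset.Iic (Fin.last n) = Finset.univ := by ext j; simp [Fin.le_last]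
      rwa [hI] at h

lemma inv_factorial_le_volume_cornerSimplex (d : ℕ) :
    ((d.factorial : ENNReal))⁻¹ ≤ volume (cornerSimplex d) := by
  have h := measure_mono (μ := volume) (orderedSimplex_subset_image_cornerSimplex d)
  rw [Measure.addHaar_image_linearMap, LinearMap.det_toLin', det_partialSumMatrix] at h
  simp only [abs_one, ENNReal.ofReal_one, one_mul] at h
  rw [ENNReal.inv_le_iff_le_mul (fun _ => Nat.cast_ne_zero.2 d.factorial_ne_zero) (by simp)]
  exact (one_le_factorial_mul_volume_orderedSimplex d).trans (by gcongr)

lemma sum_smul_mem_convexHull_insert_zero {ι E : Type*} [Fintype ι] [AddCommGroup E] [Module ℝ E]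
    (v : ι → E) (w : ι → ℝ) (hw : ∀ i, 0 ≤ w i) (hsum : ∑ i, w i ≤ 1) :
    ∑ i, w i • v i ∈ convexHull ℝ (insert (0 : E) (Set.range v)) := by
  have h := (convex_convexHull ℝ (insert (0 : E) (Set.range v))).sum_mem
    (t := (Finset.univ : Finset (Option ι))) (w := fun o => o.elim (1 - ∑ i, w i) w)
    (z := fun o => o.elim 0 v) ?_ ?_ ?_
  · simpa [Fintype.sum_option] using h
  · rintro (_ | i) -
    · simpa using hsum
    · exact hw i
  · simp [Fintype.sum_option]
  · rintro (_ | i) -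
    · exact subset_convexHull ℝ _ (Set.mem_insert _ _)
    · exact subset_convexHull ℝ _ (Set.mem_insert_of_mem _ ⟨i, rfl⟩)

lemma ofReal_abs_det_div_factorial_le_volume {d : ℕ}
    (b : OrthonormalBasis (Fin d) ℝ (EuclideanSpace ℝ (Fin d)))
    (v : Fin d → EuclideanSpace ℝ (Fin d)) :
    ENNReal.ofReal (|(Matrix.of fun i j => ⟪b i, v j⟫).det| / d.factorial) ≤
      volume (convexHull ℝ (insert (0 : EuclideanSpace ℝ (Fin d)) (Set.range v))) := by
  set M : Matrix (Fin d) (Fin d) ℝ := Matrix.of fun i j => ⟪b i, v j⟫ with hM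
  let e := b.measurableEquiv.trans (MeasurableEquiv.toLp 2 (Fin d → ℝ)).symm
  have he : MeasurePreserving e volume volume :=
    b.measurePreserving_measurableEquiv.trans
      (EuclideanSpace.volume_preserving_symm_measurableEquiv_toLp (Fin d))
  have heM (y : Fin d → ℝ) : e (∑ j, y j • v j) = M.mulVec y := by
    ext i
    change b.repr (∑ j, y j • v j) i = _
    simp [OrthonormalBasis.repr_apply_apply, hM, Matrix.mulVec,
      dotProduct, mul_comm]
  have hsub : e ⁻¹' (Matrix.toLin' M '' cornerSimplex d) ⊆
      convexHull ℝ (insert (0 : EuclideanSpace ℝ (Fin d)) (Set.range v)) := by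
    rintro x ⟨y, hy, hyx⟩
    rw [Matrix.toLin'_apply, ← heM] at hyx
    rw [← e.injective hyx]
    exact sum_smul_mem_convexHull_insert_zero v y hy.1 hy.2
  refine le_trans ?_ (measure_mono hsub)
  rw [he.measure_preimage_equiv, Measure.addHaar_image_linearMap, LinearMap.det_toLin',
    div_eq_mul_inv, ENNReal.ofReal_mul (abs_nonneg _),
    ENNReal.ofReal_inv_of_pos (by positivity), ENNReal.ofReal_natCast]
  gcongr
  exact inv_factorial_le_volume_cornerSimplex d

lemma prod_sqrt_sub_div (d : ℕ) :
    ∏ i : Fin d, Real.sqrt (((d - (i : ℕ) : ℕ) : ℝ) / (d : ℝ)) =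
      Real.sqrt d.factorial / (d : ℝ) ^ ((d : ℝ) / 2) := by
  rw [Fin.prod_univ_eq_prod_range (fun i => Real.sqrt (((d - i : ℕ) : ℝ) / (d : ℝ))) d]
  have h : ∏ i ∈ Finset.range d, (((d - i : ℕ) : ℝ)) = d.factorial := by
    rw [← Nat.cast_prod, ← Nat.descFactorial_eq_prod_range, Nat.descFactorial_self]
  simp_rw [Real.sqrt_div (Nat.cast_nonneg _)]
  rw [Finset.prod_div_distrib, ← Real.sqrt_prod _ (fun _ _ => Nat.cast_nonneg _), h,
    Finset.prod_const, Finset.card_range, Real.sqrt_eq_rpow (d : ℝ), ← Real.rpow_mul_natCast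
    (Nat.cast_nonneg _)]
  congr 2
  ring

/-- If `z 1, …, z d` is an orthonormal basis and `v 1, …, v d` are unit vectors with
`v i ∈ span{z 1, …, z i}` and `⟨v i, z i⟩ ≥ √((d−i+1)/d)` (indices `0`-based, so the
bound reads `√((d−i)/d)`), then the simplex `conv{0, v 1, …, v d}` has volume at
least `1/(√(d!) · d^(d/2))`. -/
theorem simplex_volume_lower_bound (d : ℕ)
    (z v : Fin d → EuclideanSpace ℝ (Fin d))
    (hz : Orthonormal ℝ z) (hzspan : Submodule.span ℝ (Set.range z) = ⊤)
    (hv : ∀ i, ‖v i‖ = 1)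
    (hspan : ∀ i : Fin d, v i ∈ Submodule.span ℝ (z '' {j : Fin d | j ≤ i}))
    (hip : ∀ i : Fin d,
      Real.sqrt (((d - (i : ℕ) : ℕ) : ℝ) / (d : ℝ)) ≤ ⟪v i, z i⟫) :
    ENNReal.ofReal
        (1 / (Real.sqrt (d.factorial) * (d : ℝ) ^ ((d : ℝ) / 2))) ≤
      volume (convexHull ℝ (insert (0 : EuclideanSpace ℝ (Fin d))
        (Set.range v))) := by
  let b := OrthonormalBasis.mk hz hzspan.ge
  have hb : ⇑b = z := OrthonormalBasis.coe_mk hz hzspan.ge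
  refine le_trans (ENNReal.ofReal_le_ofReal ?_) (ofReal_abs_det_div_factorial_le_volume b v)
  rw [hb]
  have hdet : (Matrix.of fun i j => ⟪z i, v j⟫).det = ∏ i, ⟪v i, z i⟫ := by
    rw [Matrix.det_of_isUpperTriangular]
    · simp [real_inner_comm]
    · intro i j hij
      have hji : j < i := hij
      have hle : Submodule.span ℝ (z '' {k : Fin d | k ≤ j}) ≤ (ℝ ∙ z i)ᗮ := by
        rw [Submodule.span_le]
        rintro _ ⟨k, hk, rfl⟩
        exact Submodule.mem_orthogonal_singleton_iff_inner_right.2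
          (hz.2 (lt_of_le_of_lt hk hji).ne')
      exact Submodule.mem_orthogonal_singleton_iff_inner_right.1 (hle (hspan j))
  have hprod : Real.sqrt d.factorial / (d : ℝ) ^ ((d : ℝ) / 2) ≤ ∏ i, ⟪v i, z i⟫ := by
    rw [← prod_sqrt_sub_div]
    exact Finset.prod_le_prod (fun _ _ => Real.sqrt_nonneg _) fun i _ => hip i
  rw [hdet]
  calc 1 / (Real.sqrt d.factorial * (d : ℝ) ^ ((d : ℝ) / 2))
      = Real.sqrt d.factorial / (d : ℝ) ^ ((d : ℝ) / 2) / d.factorial := by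
        have hf : (0 : ℝ) < d.factorial := by positivity
        have hs : Real.sqrt d.factorial ≠ 0 := (Real.sqrt_pos.2 hf).ne'
        nth_rewrite 3 [← Real.mul_self_sqrt hf.le]
        rw [div_right_comm, div_mul_cancel_left₀ hs, mul_comm, one_div, mul_inv]
        ring
    _ ≤ _ := by
        gcongr
        exact hprod.trans (le_abs_self _)
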